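/- (Value preservation of the constructed homomorphic chain.) Let P_ν be an m×n real matrix with P_ν P_νᵀ invertible and P_ν† = P_νᵀ (P_ν P_νᵀ)⁻¹. Let P be a row-stochastic n×n real matrix such that P = D · P_ν for some n×m real matrix D, let γ ∈ (0,1), let R ∈ ℝⁿ, and let V_S = (I − γP)⁻¹ R. Then the vector V_U := P_ν V_S satisfies the abstract Bellman equation V_U = P_ν R + γ (P_ν · P · P_ν†) V_U. -/

import Mathlib

open Matrix

/-- A real matrix is row-stochastic if all its entries are nonnegative and each row sums to 1. -/
def RowStochastic {n : Type*} [Fintype n] (P : Matrix n n ℝ) : Prop :=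
  (∀ i j, 0 ≤ P i j) ∧ ∀ i, ∑ j, P i j = 1

/-- `1 - γ P` is invertible for `P` row-stochastic and `γ ∈ (0,1)`, since it is strictly
diagonally dominant. -/
theorem RowStochastic.isUnit_det_one_sub_smul {n : Type*} [Fintype n] [DecidableEq n]
    {P : Matrix n n ℝ} (hP : RowStochastic P) {γ : ℝ} (hγ : γ ∈ Set.Ioo (0 : ℝ) 1) :
    IsUnit (1 - γ • P).det := by
  refine isUnit_iff_ne_zero.2 (det_ne_zero_of_sum_row_lt_diag fun k => ?_)
  have hoff : ∑ j ∈ Finset.univ.erase k, ‖(1 - γ • P) k j‖ =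
      γ * ∑ j ∈ Finset.univ.erase k, P k j := by
    rw [Finset.mul_sum]
    refine Finset.sum_congr rfl fun j hj => ?_
    have hkj : k ≠ j := (Finset.ne_of_mem_erase hj).symm
    simp [hkj, abs_of_nonneg (hP.1 k j), abs_of_pos hγ.1]
  have hsum : P k k + ∑ j ∈ Finset.univ.erase k, P k j = 1 := by
    rw [Finset.add_sum_erase _ _ (Finset.mem_univ k), hP.2 k]
  have hdiag : 1 - γ * P k k ≤ ‖(1 - γ • P) k k‖ := by
    simpa using le_abs_self (1 - γ * P k k)
  rw [hoff, eq_sub_of_add_eq' hsum]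
  linarith [hγ.2]

/-- The Bellman equation for the value function of a row-stochastic matrix. -/
theorem RowStochastic.bellman {n : Type*} [Fintype n] [DecidableEq n]
    {P : Matrix n n ℝ} (hP : RowStochastic P) {γ : ℝ} (hγ : γ ∈ Set.Ioo (0 : ℝ) 1) (R : n → ℝ) :
    (1 - γ • P)⁻¹ *ᵥ R = R + γ • (P *ᵥ ((1 - γ • P)⁻¹ *ᵥ R)) := by
  have h : (1 - γ • P) *ᵥ ((1 - γ • P)⁻¹ *ᵥ R) = R := by
    rw [mulVec_mulVec, mul_nonsing_inv _ (hP.isUnit_det_one_sub_smul hγ), one_mulVec]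
  rw [sub_mulVec, one_mulVec, smul_mulVec] at h
  exact sub_eq_iff_eq_add.1 h

/-- **Value preservation of the constructed homomorphic chain.**
With `P_ν P_νᵀ` invertible, `P_ν† = P_νᵀ (P_ν P_νᵀ)⁻¹`, `P = D ⬝ P_ν` row-stochastic,
`γ ∈ (0,1)` and `V_S = (I - γP)⁻¹ R`, the vector `V_U := P_ν V_S` satisfies the abstract
Bellman equation `V_U = P_ν R + γ (P_ν P P_ν†) V_U`. -/
theorem constructed_chain_value_preservation {m n : Type*} [Fintype m] [Fintype n]
    [DecidableEq m] [DecidableEq n]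
    (P_ν : Matrix m n ℝ) (hν : IsUnit (P_ν * P_νᵀ))
    (P : Matrix n n ℝ) (hP : RowStochastic P)
    (D : Matrix n m ℝ) (hD : P = D * P_ν)
    (γ : ℝ) (hγ : γ ∈ Set.Ioo (0 : ℝ) 1) (R : n → ℝ)
    (V_S : n → ℝ) (hVS : V_S = (1 - γ • P)⁻¹ *ᵥ R)
    (V_U : m → ℝ) (hVU : V_U = P_ν *ᵥ V_S) :
    V_U = P_ν *ᵥ R + γ • ((P_ν * P * (P_νᵀ * (P_ν * P_νᵀ)⁻¹)) *ᵥ V_U) := by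
  have hproj : P * (P_νᵀ * (P_ν * P_νᵀ)⁻¹) * P_ν = P := by
    rw [hD, ← Matrix.mul_assoc, Matrix.mul_assoc D, Matrix.mul_assoc D,
      mul_nonsing_inv _ ((isUnit_iff_isUnit_det _).1 hν), Matrix.mul_one]
  have hbellman : V_S = R + γ • (P *ᵥ V_S) := by
    rw [hVS]
    exact hP.bellman hγ R
  calc V_U = P_ν *ᵥ (R + γ • (P *ᵥ V_S)) := by rw [hVU, ← hbellman]
    _ = P_ν *ᵥ R + γ • ((P_ν * P * (P_νᵀ * (P_ν * P_νᵀ)⁻¹)) *ᵥ V_U) := by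
      rw [hVU, mulVec_add, mulVec_smul, mulVec_mulVec, mulVec_mulVec, Matrix.mul_assoc P_ν,
        Matrix.mul_assoc P_ν, hproj]
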